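/- Let n, t with 1 ≤ t < n−1 and let s : Fin n → ℝ be nonnegative and nonincreasing. Then there exists a feasible nonnegative nonincreasing vector v minimizing ∑_i v i such that for some ξ with 1 ≤ ξ ≤ min(⌊(2n−t)/(n−t)⌋, t+1): v ξ = v_{ξ+1} = ⋯ = v n, and v j + ∑_{i=t+2}^{n} v i = s j for all j ≤ ξ. -/

import Mathlib

/-- Among the subsets of a given size there is one whose average is at most the overall average. -/
theorem Finset.exists_subset_card_eq_card_mul_sum_le {ι : Type*} [DecidableEq ι] (f : ι → ℝ)
    (q : ℕ) (D : Finset ι) (hq : q ≤ D.card) :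
    ∃ B ⊆ D, B.card = q ∧ (D.card : ℝ) * ∑ i ∈ B, f i ≤ q * ∑ i ∈ D, f i := by
  induction hd : D.card generalizing D with
  | zero =>
    have hq0 : q = 0 := by omega
    exact ⟨∅, by simp, by simp [hq0], by simp [hq0]⟩
  | succ d ih =>
    rcases Nat.eq_or_lt_of_le hq with h | h
    · exact ⟨D, subset_rfl, h.symm, by rw [← hd, ← h]⟩
    obtain ⟨x, hx, hmax⟩ := D.exists_max_image f (Finset.card_pos.mp (by omega))
    have hcard : (D.erase x).card = d := by rw [Finset.card_erase_of_mem hx, hd]; rfl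
    obtain ⟨B, hB, hBq, hle⟩ := ih (D.erase x) (by omega) hcard
    refine ⟨B, hB.trans (Finset.erase_subset _ _), hBq, ?_⟩
    rcases Nat.eq_zero_or_pos d with rfl | hpos
    · have hq0 : q = 0 := by omega
      have hB0 : B = ∅ := Finset.card_eq_zero.mp (hBq.trans hq0)
      simp [hB0, hq0]
    have hsplit := Finset.add_sum_erase D f hx
    have hbound : ∑ i ∈ D.erase x, f i ≤ d * f x := by
      have := Finset.sum_le_card_nsmul (D.erase x) f (f x)
        (fun i hi => hmax i (Finset.mem_of_mem_erase hi))
      rwa [hcard, nsmul_eq_mul] at this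
    have hd0 : (0 : ℝ) < d := by exact_mod_cast hpos
    have hqx := mul_le_mul_of_nonneg_left hbound (Nat.cast_nonneg (α := ℝ) q)
    have hle' := mul_le_mul_of_nonneg_left hle (by positivity : (0 : ℝ) ≤ d + 1)
    refine le_of_mul_le_mul_left ?_ hd0
    push_cast
    rw [← hsplit]
    linarith

theorem Fin.sum_univ_eq_sum_Iio_add_sum_Ioi {n : ℕ} (f : Fin n → ℝ) (μ : Fin n) :
    ∑ i, f i = ∑ i ∈ Finset.Iio μ, f i + f μ + ∑ i ∈ Finset.Ioi μ, f i := by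
  have hμ : μ ∉ Finset.Ioi μ := by simp
  have hdisj : Disjoint (Finset.Iio μ) (insert μ (Finset.Ioi μ)) := by
    rw [Finset.disjoint_left]
    intro i hi
    simp only [Finset.mem_Iio] at hi
    simp only [Finset.mem_insert, Finset.mem_Ioi, not_or]
    exact ⟨hi.ne, hi.not_gt⟩
  have huniv : (Finset.univ : Finset (Fin n)) = Finset.Iio μ ∪ insert μ (Finset.Ioi μ) := by
    ext i
    simp only [Finset.mem_univ, Finset.mem_union, Finset.mem_Iio, Finset.mem_insert,
      Finset.mem_Ioi, true_iff]
    exact lt_trichotomy i μ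
  rw [huniv, Finset.sum_union hdisj, Finset.sum_insert hμ, add_assoc]

/-- If every `k`-subset containing `j` has `w`-weight at least `s j`, then the total weight is
bounded below by a dual solution supported on the indices up to `m = n / k`. -/
theorem mul_sum_add_mod_mul_le_of_forall_card_eq {n k : ℕ} (hk : 2 ≤ k) (hkn : k < n)
    (s w : Fin n → ℝ) (μ : Fin n) (hμ : μ.val = n / k)
    (hw : ∀ (j : Fin n) (B : Finset (Fin n)), B.card = k → j ∈ B → s j ≤ ∑ i ∈ B, w i) :
    (k : ℝ) * ∑ i ∈ Finset.Iio μ, s i + (n % k : ℕ) * s μ ≤ k * ∑ i, w i := by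
  have hdiv : k * μ.val + n % k = n := by rw [hμ]; exact Nat.div_add_mod n k
  have hr : n % k < k := Nat.mod_lt _ (by omega)
  set m := μ.val with hm
  set r := n % k
  have hm1 : 1 ≤ m := by rw [hμ]; exact Nat.div_pos hkn.le (by omega)
  have hL : k + m ≤ n := by
    rcases Nat.eq_or_lt_of_le hm1 with h | h
    · omega
    · nlinarith [Nat.mul_le_mul hk h]
  have hcardD : (Finset.Ioi μ).card = n - 1 - m := by simp [hm]
  obtain ⟨B, hBD, hBc, hB⟩ := Finset.exists_subset_card_eq_card_mul_sum_le w (k - 1)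
    (Finset.Ioi μ) (by omega)
  obtain ⟨C, hCD, hCc, hC⟩ := Finset.exists_subset_card_eq_card_mul_sum_le w (k - 2)
    (Finset.Ioi μ) (by omega)
  have hgt : ∀ {E : Finset (Fin n)}, E ⊆ Finset.Ioi μ → ∀ j ≤ μ, j ∉ E := fun hE j hj hjE =>
    absurd (Finset.mem_Ioi.mp (hE hjE)) (not_lt.mpr hj)
  have hinsert : ∀ j ≤ μ, s j ≤ w j + ∑ i ∈ B, w i := fun j hj => by
    have := hw j (insert j B) (by rw [Finset.card_insert_of_notMem (hgt hBD j hj)]; omega)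
      (Finset.mem_insert_self _ _)
    rwa [Finset.sum_insert (hgt hBD j hj)] at this
  have hinsert₂ : ∀ j < μ, s j ≤ w j + (w μ + ∑ i ∈ C, w i) := fun j hj => by
    have hjμ : j ∉ insert μ C := by simp [hj.ne, hgt hCD j hj.le]
    have := hw j (insert j (insert μ C))
      (by rw [Finset.card_insert_of_notMem hjμ,
        Finset.card_insert_of_notMem (hgt hCD μ le_rfl)]; omega)
      (Finset.mem_insert_self _ _)
    rwa [Finset.sum_insert hjμ, Finset.sum_insert (hgt hCD μ le_rfl)] at this
  rw [hcardD] at hB hC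
  set Y := ∑ i ∈ Finset.Ioi μ, w i with hY
  have hLpos : (0 : ℝ) < (n - 1 - m : ℕ) := by exact_mod_cast (by omega : 0 < n - 1 - m)
  have hLcast : ((n - 1 - m : ℕ) : ℝ) = m * k + r - 1 - m := by
    have : n - 1 - m + 1 + m = m * k + r := by rw [mul_comm m k]; omega
    have : ((n - 1 - m : ℕ) : ℝ) + 1 + m = m * k + r := by exact_mod_cast this
    linarith
  set L : ℝ := ((n - 1 - m : ℕ) : ℝ)
  obtain ⟨y, hy⟩ : ∃ y, Y = L * y := ⟨Y / L, by field_simp⟩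
  have hB' : ∑ i ∈ B, w i ≤ (k - 1) * y := by
    refine le_of_mul_le_mul_left ?_ hLpos
    rw [Nat.cast_sub (by omega), hy] at hB
    push_cast at hB
    linarith
  have hC' : ∑ i ∈ C, w i ≤ (k - 2) * y := by
    refine le_of_mul_le_mul_left ?_ hLpos
    rw [Nat.cast_sub (by omega), hy] at hC
    push_cast at hC
    linarith
  have hrk : (r : ℝ) ≤ k := by exact_mod_cast hr.le
  have hm1' : (1 : ℝ) ≤ m := by exact_mod_cast hm1
  have hm0 : (0 : ℝ) < m := by linarith
  have hcoef : (0 : ℝ) ≤ k * m - (k - r) := by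
    nlinarith [Nat.cast_nonneg (α := ℝ) k, Nat.cast_nonneg (α := ℝ) r]
  have hterm : ∀ j ∈ Finset.Iio μ, (k * m : ℝ) * s j ≤
      k * m * w j + ((k - r) * w μ + (k * m * (k - 1) - (k - r)) * y) := fun j hj => by
    have hj := Finset.mem_Iio.mp hj
    have h₁ := mul_le_mul_of_nonneg_left ((hinsert₂ j hj).trans
      (by linarith : _ ≤ w j + (w μ + (k - 2) * y))) (sub_nonneg.mpr hrk)
    have h₂ := mul_le_mul_of_nonneg_left ((hinsert j hj.le).trans
      (by linarith : _ ≤ w j + (k - 1) * y)) hcoef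
    linarith
  have hsum := Finset.sum_le_sum hterm
  rw [Finset.sum_add_distrib, ← Finset.mul_sum, ← Finset.mul_sum, Finset.sum_const, Fin.card_Iio,
    nsmul_eq_mul, ← hm] at hsum
  have hsum' : k * ∑ i ∈ Finset.Iio μ, s i ≤
      k * ∑ i ∈ Finset.Iio μ, w i + ((k - r) * w μ + (k * m * (k - 1) - (k - r)) * y) := by
    refine le_of_mul_le_mul_left ?_ hm0
    linarith
  have hlast := mul_le_mul_of_nonneg_left ((hinsert μ le_rfl).trans
    (by linarith : _ ≤ w μ + (k - 1) * y)) (Nat.cast_nonneg (α := ℝ) r)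
  rw [Fin.sum_univ_eq_sum_Iio_add_sum_Ioi w μ, ← hY, hy, hLcast]
  linarith

theorem stmt6 (n t : ℕ) (ht : 1 ≤ t) (htn : t + 1 < n)
    (s : Fin n → ℝ) (hs0 : ∀ i, 0 ≤ s i)
    (hsmono : ∀ i j : Fin n, i ≤ j → s j ≤ s i) :
    ∃ (v : Fin n → ℝ) (ξ : ℕ),
      (∀ i, 0 ≤ v i) ∧
      (∀ i j : Fin n, i ≤ j → v j ≤ v i) ∧
      (∀ (j : Fin n) (A : Finset (Fin n)), A.card = t → j ∉ A →
        s j ≤ ∑ i ∈ Aᶜ, v i) ∧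
      (∀ w : Fin n → ℝ, (∀ i, 0 ≤ w i) →
        (∀ (j : Fin n) (A : Finset (Fin n)), A.card = t → j ∉ A →
          s j ≤ ∑ i ∈ Aᶜ, w i) →
        ∑ i, v i ≤ ∑ i, w i) ∧
      1 ≤ ξ ∧ ξ ≤ min ((2 * n - t) / (n - t)) (t + 1) ∧
      (∀ i j : Fin n, ξ - 1 ≤ i.val → ξ - 1 ≤ j.val → v i = v j) ∧
      (∀ j : Fin n, j.val < ξ →
        v j + ∑ i ∈ Finset.univ.filter (fun i : Fin n => t + 1 ≤ i.val), v i = s j) := by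
  obtain ⟨k, rfl⟩ : ∃ k, n = k + t := ⟨n - t, by omega⟩
  have hk : 2 ≤ k := by omega
  have hmt : (k + t) / k ≤ t := by
    rw [← Nat.lt_succ_iff, Nat.div_lt_iff_lt_mul (by omega)]
    nlinarith [Nat.mul_le_mul hk ht]
  set μ : Fin (k + t) := ⟨(k + t) / k, by omega⟩
  have hμ : μ.val = (k + t) / k := rfl
  have hk0 : (0 : ℝ) < k := by exact_mod_cast (by omega : 0 < k)
  obtain ⟨c, hc⟩ : ∃ c, s μ = k * c := ⟨s μ / k, by field_simp⟩
  have hc0 : 0 ≤ c := nonneg_of_mul_nonneg_right (hc ▸ hs0 μ) hk0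
  have hsμ : ∀ i, k * c ≤ s (min i μ) := fun i => hc ▸ hsmono _ _ (min_le_right i μ)
  have hge : ∀ i, μ ≤ i → s (min i μ) - (k - 1) * c = c := fun i hi => by
    rw [min_eq_right hi, hc]; ring
  refine ⟨fun i => s (min i μ) - (k - 1) * c, μ.val + 1, ?_, ?_, ?_, ?_, by omega, ?_, ?_, ?_⟩
  · intro i
    linarith [hsμ i]
  · intro i j hij
    linarith [hsmono _ _ (min_le_min_right μ hij)]
  · intro j A hA hj
    have hj' : j ∈ Aᶜ := Finset.mem_compl.mpr hj
    have hcard : (Aᶜ.erase j).card = k - 1 := by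
      rw [Finset.card_erase_of_mem hj', Finset.card_compl, Fintype.card_fin, hA]; omega
    have hrest := Finset.card_nsmul_le_sum (Aᶜ.erase j) (fun i => s (min i μ) - (k - 1) * c) c
      (fun i _ => by linarith [hsμ i])
    rw [hcard, nsmul_eq_mul, Nat.cast_sub (by omega), Nat.cast_one] at hrest
    rw [← Finset.add_sum_erase _ _ hj']
    linarith [hsmono _ _ (min_le_left j μ)]
  · intro w _ hw
    have hlow := mul_sum_add_mod_mul_le_of_forall_card_eq hk (by omega) s w μ hμ
      (fun j B hB hj => by
        simpa using hw j Bᶜ (by rw [Finset.card_compl, Fintype.card_fin, hB]; omega)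
          (by simpa using hj))
    refine le_of_mul_le_mul_left (le_trans (le_of_eq ?_) hlow) hk0
    rw [Fin.sum_univ_eq_sum_Iio_add_sum_Ioi _ μ, hge μ le_rfl,
      Finset.sum_congr (g := fun _ => c) rfl
        (fun i (hi : i ∈ Finset.Ioi μ) => hge i (Finset.mem_Ioi.mp hi).le),
      Finset.sum_congr (g := fun i => s i - (k - 1) * c) rfl
        (fun i (hi : i ∈ Finset.Iio μ) => by rw [min_eq_left (Finset.mem_Iio.mp hi).le]),
      Finset.sum_sub_distrib, Finset.sum_const, Finset.sum_const, Fin.card_Iio, Fin.card_Ioi,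
      nsmul_eq_mul, nsmul_eq_mul, hc]
    have hdiv : k * μ.val + (k + t) % k = k + t := Nat.div_add_mod _ _
    have hL : k + t - 1 - μ.val + 1 + μ.val = k * μ.val + (k + t) % k := by omega
    have hL' : ((k + t - 1 - μ.val : ℕ) : ℝ) = k * μ.val + ((k + t) % k : ℕ) - 1 - μ.val := by
      have : ((k + t - 1 - μ.val : ℕ) : ℝ) + 1 + μ.val = k * μ.val + ((k + t) % k : ℕ) := by
        exact_mod_cast hL
      linarith
    rw [hL']
    ring
  · have h₁ : 2 * (k + t) - t = k + t + k := by omega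
    rw [h₁, Nat.add_sub_cancel, Nat.add_div_right _ (by omega), ← hμ]
    exact le_min le_rfl (by omega)
  · intro i j hi hj
    exact (hge i (Fin.le_def.mpr (by omega))).trans (hge j (Fin.le_def.mpr (by omega))).symm
  · intro j hj
    have hjμ : j ≤ μ := Fin.le_def.mpr (by omega)
    have hfilter : Finset.univ.filter (fun i : Fin (k + t) => t + 1 ≤ i.val) =
        Finset.Ioi ⟨t, by omega⟩ := by
      ext i
      simp [Fin.lt_def]
    have hcard : k + t - 1 - t = k - 1 := by omega
    rw [hfilter, Finset.sum_congr (g := fun _ => c) rfl (fun i hi => hge i (Fin.le_def.mpr (by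
        have := Fin.lt_def.mp (Finset.mem_Ioi.mp hi)
        simp only at this
        omega))), Finset.sum_const, Fin.card_Ioi, hcard, nsmul_eq_mul,
      Nat.cast_sub (by omega)]
    simp only [min_eq_left hjμ]
    push_cast
    ring
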